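/- arXiv:1308.3889 — 2 statements merged into one kernel-verified Lean document; each statement's English description precedes it below -/
import Mathlib

section
/- Let γ ∈ [0,1]. With ℓ₁ and ℓ₂ the eigenvalues of ā(v) = (a*μ)(v) given by ℓ₁(v) := ∫_{ℝ³} (1 − ((v/|v|)·(w/|w|))²) |w|^{γ+2} μ(v−w) dw and ℓ₂(v) := ∫_{ℝ³} (1 − ½ |(v/|v|) × (w/|w|)|²) |w|^{γ+2} μ(v−w) dw, one has the asymptotics ℓ₁(v)/|v|^γ → 2 and ℓ₂(v)/|v|^{γ+2} → 1 as |v| → ∞. -/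
open MeasureTheory Real Filter

noncomputable section

abbrev E3 : Type := EuclideanSpace ℝ (Fin 3)

/-- The standard Gaussian on ℝ³. -/
def gauss (v : E3) : ℝ :=
  (2 * π) ^ (-(3 : ℝ) / 2) * Real.exp (-‖v‖ ^ 2 / 2)

/-- `J_α(v) = ∫ |v - w|^α μ(w) dw`. -/
def Jfun (α : ℝ) (v : E3) : ℝ :=
  ∫ w : E3, ‖v - w‖ ^ α * gauss w

/-- The matrix `a_{ij}(z) = |z|^{γ+2} (δ_{ij} - z_i z_j / |z|²)` (equal to `0` at `z = 0`). -/
def amat (γ : ℝ) (z : E3) (i j : Fin 3) : ℝ :=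
  ‖z‖ ^ (γ + 2) * ((if i = j then (1 : ℝ) else 0) - z i * z j / ‖z‖ ^ 2)

/-- The entrywise convolution `ā = a * μ`. -/
def abar (γ : ℝ) (v : E3) (i j : Fin 3) : ℝ :=
  ∫ w : E3, amat γ (v - w) i j * gauss w

/-- The eigenvalue `ℓ₁(v)` of `ā(v)` in the direction `v`. -/
def ell1 (γ : ℝ) (v : E3) : ℝ :=
  ∫ w : E3, (1 - (∑ i, (v i / ‖v‖) * (w i / ‖w‖)) ^ 2) * ‖w‖ ^ (γ + 2) * gauss (v - w)

/-- Squared norm of the cross product of two vectors of ℝ³. -/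
def crossSq (u w : Fin 3 → ℝ) : ℝ :=
  (u 1 * w 2 - u 2 * w 1) ^ 2 + (u 2 * w 0 - u 0 * w 2) ^ 2 + (u 0 * w 1 - u 1 * w 0) ^ 2

/-- The eigenvalue `ℓ₂(v)` of `ā(v)` on `v^⊥`. -/
def ell2 (γ : ℝ) (v : E3) : ℝ :=
  ∫ w : E3, (1 - (1 / 2) * crossSq (fun i => v i / ‖v‖) (fun i => w i / ‖w‖)) *
    ‖w‖ ^ (γ + 2) * gauss (v - w)

lemma aux_phi (x : ℝ) : ProbabilityTheory.gaussianPDFReal 0 1 x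
    = (√(2 * π))⁻¹ * Real.exp (-x ^ 2 / 2) := by
  simp [ProbabilityTheory.gaussianPDFReal]

lemma aux_m0 : ∫ x : ℝ, x ^ 0 * ProbabilityTheory.gaussianPDFReal 0 1 x = 1 := by
  simpa using ProbabilityTheory.integral_gaussianPDFReal_eq_one 0 (v := 1) one_ne_zero

lemma aux_m1 : ∫ x : ℝ, x ^ 1 * ProbabilityTheory.gaussianPDFReal 0 1 x = 0 := by
  have h := ProbabilityTheory.integral_id_gaussianReal (μ := 0) (v := 1)
  rw [ProbabilityTheory.integral_gaussianReal_eq_integral_smul one_ne_zero] at h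
  refine Eq.trans ?_ h
  congr 1; ext x; simp [mul_comm]

lemma aux_m2 : ∫ x : ℝ, x ^ 2 * ProbabilityTheory.gaussianPDFReal 0 1 x = 1 := by
  have h := ProbabilityTheory.variance_fun_id_gaussianReal (μ := 0) (v := 1)
  rw [ProbabilityTheory.variance_of_integral_eq_zero (by fun_prop)
    ProbabilityTheory.integral_id_gaussianReal,
    ProbabilityTheory.integral_gaussianReal_eq_integral_smul one_ne_zero] at h
  simp only [NNReal.coe_one] at h
  rw [← h]
  congr 1; ext x; simp [mul_comm]

lemma aux_norm_sq (v : E3) : ‖v‖ ^ 2 = v 0 ^ 2 + v 1 ^ 2 + v 2 ^ 2 := by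
  rw [EuclideanSpace.real_norm_sq_eq, Fin.sum_univ_three]

lemma aux_gauss_prod (v : E3) :
    gauss v = ∏ i, ProbabilityTheory.gaussianPDFReal 0 1 (v i) := by
  rw [gauss, Fin.prod_univ_three, aux_phi, aux_phi, aux_phi, aux_norm_sq]
  have h : (2 * π) ^ (-(3 : ℝ) / 2) = (√(2 * π))⁻¹ * (√(2 * π))⁻¹ * (√(2 * π))⁻¹ := by
    have hp : (0 : ℝ) < 2 * π := by positivity
    rw [Real.sqrt_eq_rpow, ← Real.rpow_neg hp.le, ← Real.rpow_add hp, ← Real.rpow_add hp]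
    norm_num
  rw [h, show -(v 0 ^ 2 + v 1 ^ 2 + v 2 ^ 2) / 2 = -v 0 ^ 2 / 2 + -v 1 ^ 2 / 2 + -v 2 ^ 2 / 2 by ring,
    Real.exp_add, Real.exp_add]
  ring

lemma aux_moment (n : Fin 3 → ℕ) :
    ∫ v : E3, (∏ i, v i ^ n i) * gauss v
      = ∏ i, ∫ x : ℝ, x ^ n i * ProbabilityTheory.gaussianPDFReal 0 1 x := by
  rw [← integral_fintype_prod_volume_eq_prod
    (fun i (x : ℝ) => x ^ n i * ProbabilityTheory.gaussianPDFReal 0 1 x),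
    ← (PiLp.volume_preserving_toLp (Fin 3)).integral_comp
      (MeasurableEquiv.toLp 2 (Fin 3 → ℝ)).measurableEmbedding]
  congr 1; ext x
  rw [aux_gauss_prod, ← Finset.prod_mul_distrib]

lemma aux_gauss_nonneg (v : E3) : 0 ≤ gauss v := by unfold gauss; positivity

lemma aux_gauss_cont : Continuous gauss := by unfold gauss; fun_prop

lemma aux_int : Integrable (fun u : E3 => (1 + ‖u‖ ^ 4) * gauss u) := by
  have h := (GaussianFourier.integrable_cexp_neg_mul_sq_norm_add (V := E3)
    (b := (1 / 4 : ℝ)) (by rw [Complex.ofReal_re]; norm_num) 0 0).norm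
  refine (h.const_mul (33 * (2 * π) ^ (-(3 : ℝ) / 2))).mono'
    ((by have := aux_gauss_cont; fun_prop : Continuous _).aestronglyMeasurable) ?_
  refine Eventually.of_forall fun u => ?_
  rw [Real.norm_of_nonneg (mul_nonneg (by positivity) (aux_gauss_nonneg u)), Complex.norm_exp]
  have e : (-((1 / 4 : ℝ) : ℂ) * (‖u‖ : ℂ) ^ 2 + 0 * ((inner ℝ (0 : E3) u : ℝ) : ℂ)).re
      = -‖u‖ ^ 2 / 4 := by
    rw [zero_mul, add_zero, ← Complex.ofReal_pow, ← Complex.ofReal_neg, ← Complex.ofReal_mul,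
      Complex.ofReal_re]
    ring
  rw [e, gauss, show -‖u‖ ^ 2 / 2 = -‖u‖ ^ 2 / 4 + -(‖u‖ ^ 2 / 4) by ring, Real.exp_add]
  have h1 : 1 + ‖u‖ ^ 4 ≤ 33 * Real.exp (‖u‖ ^ 2 / 4) := by
    have a := Real.pow_div_factorial_le_exp (‖u‖ ^ 2 / 4) (by positivity) 2
    have b := Real.one_le_exp (x := ‖u‖ ^ 2 / 4) (by positivity)
    norm_num [Nat.factorial] at a
    nlinarith
  have h2 : (1 + ‖u‖ ^ 4) * Real.exp (-(‖u‖ ^ 2 / 4)) ≤ 33 := by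
    rw [Real.exp_neg, ← div_eq_mul_inv, div_le_iff₀ (Real.exp_pos _)]; exact h1
  have h3 : 0 ≤ (2 * π) ^ (-(3 : ℝ) / 2) * Real.exp (-‖u‖ ^ 2 / 4) := by positivity
  nlinarith [mul_le_mul_of_nonneg_left h2 h3]

lemma aux_int_of_le {F : E3 → ℝ} (hF : Measurable F) (C : ℝ)
    (h : ∀ u, |F u| ≤ C * (1 + ‖u‖ ^ 4)) : Integrable (fun u => F u * gauss u) := by
  refine (aux_int.const_mul C).mono'
    (hF.mul aux_gauss_cont.measurable).aestronglyMeasurable (Eventually.of_forall fun u => ?_)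
  rw [Real.norm_eq_abs, abs_mul, abs_of_nonneg (aux_gauss_nonneg u), ← mul_assoc]
  exact mul_le_mul_of_nonneg_right (h u) (aux_gauss_nonneg u)

lemma aux_diff {F G : E3 → ℝ} (hF : Measurable F) (hG : Measurable G) (C K : ℝ)
    (hGK : ∀ u, |G u| ≤ K * (1 + ‖u‖ ^ 4))
    (h : ∀ u, |F u - G u| ≤ C * (1 + ‖u‖ ^ 4)) :
    |(∫ u, F u * gauss u) - ∫ u, G u * gauss u| ≤ C * ∫ u : E3, (1 + ‖u‖ ^ 4) * gauss u := by
  have iG := aux_int_of_le hG K hGK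
  have iF := aux_int_of_le hF (C + K) fun u => by
    have := abs_add_le (F u - G u) (G u)
    rw [sub_add_cancel] at this
    linarith [h u, hGK u]
  rw [← integral_sub iF iG, ← integral_const_mul, ← Real.norm_eq_abs]
  refine norm_integral_le_of_norm_le (aux_int.const_mul C) (Eventually.of_forall fun u => ?_)
  rw [← sub_mul, Real.norm_eq_abs, abs_mul, abs_of_nonneg (aux_gauss_nonneg u), ← mul_assoc]
  exact mul_le_mul_of_nonneg_right (h u) (aux_gauss_nonneg u)

lemma aux_coord (u : E3) (i : Fin 3) : |u i| ≤ ‖u‖ := by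
  simpa using PiLp.norm_apply_le u i

lemma aux_pow2 (r : ℝ) : r ^ 2 ≤ 1 + r ^ 4 := by nlinarith [sq_nonneg (r ^ 2 - 1)]

lemma aux_int2 (i j : Fin 3) : Integrable (fun u : E3 => (u i * u j) * gauss u) := by
  refine aux_int_of_le (by fun_prop) 1 fun u => ?_
  rw [abs_mul]
  nlinarith [aux_coord u i, aux_coord u j, abs_nonneg (u i), abs_nonneg (u j), aux_pow2 ‖u‖,
    norm_nonneg u]

lemma aux_mom2 (i j : Fin 3) : ∫ u : E3, (u i * u j) * gauss u = if i = j then 1 else 0 := by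
  have h := aux_moment (fun k => (if k = i then 1 else 0) + (if k = j then 1 else 0))
  rw [show (fun u : E3 => (u i * u j) * gauss u) = fun u : E3 =>
      (∏ k, u k ^ ((if k = i then 1 else 0) + (if k = j then 1 else 0))) * gauss u by
    ext u
    congr 1
    simp_rw [pow_add, Finset.prod_mul_distrib, pow_ite]
    simp, h,
    Fin.prod_univ_three]
  have a0 := aux_m0
  have a1 := aux_m1
  have a2 := aux_m2
  fin_cases i <;> fin_cases j <;> norm_num <;> simp_all

/-- the quadratic form `|u|² - (v̂·u)²` -/
def qf (v u : E3) : ℝ := ‖u‖ ^ 2 - (∑ i, v i / ‖v‖ * u i) ^ 2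

lemma aux_unit (v : E3) (hv : ‖v‖ ≠ 0) :
    (v 0 / ‖v‖) ^ 2 + (v 1 / ‖v‖) ^ 2 + (v 2 / ‖v‖) ^ 2 = 1 := by
  have := aux_norm_sq v
  field_simp
  linarith

lemma aux_qf_int (v : E3) (hv : ‖v‖ ≠ 0) : ∫ u, qf v u * gauss u = 2 := by
  have h1 := aux_unit v hv
  have e : (fun u => qf v u * gauss u) = fun u : E3 => ∑ i, ∑ j,
      ((if i = j then 1 else 0) - (v i / ‖v‖) * (v j / ‖v‖)) * ((u i * u j) * gauss u) := by
    ext u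
    simp [qf, aux_norm_sq, Fin.sum_univ_three]
    ring
  rw [e, integral_finsetSum _ fun i _ => integrable_finsetSum _ fun j _ =>
    (aux_int2 i j).const_mul _]
  simp_rw [integral_finsetSum _ fun j _ => (aux_int2 _ j).const_mul _, integral_const_mul, aux_mom2]
  simp [Fin.sum_univ_three]
  linarith

lemma aux_qf_bd (v u : E3) (hv : ‖v‖ ≠ 0) : 0 ≤ qf v u ∧ qf v u ≤ ‖u‖ ^ 2 := by
  have h1 := aux_unit v hv
  refine ⟨?_, by unfold qf; nlinarith [sq_nonneg (∑ i, v i / ‖v‖ * u i)]⟩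
  unfold qf
  rw [aux_norm_sq, Fin.sum_univ_three]
  generalize v 0 / ‖v‖ = a at *
  generalize v 1 / ‖v‖ = b at *
  generalize v 2 / ‖v‖ = c at *
  have : u 0 ^ 2 + u 1 ^ 2 + u 2 ^ 2 = (a ^ 2 + b ^ 2 + c ^ 2) * (u 0 ^ 2 + u 1 ^ 2 + u 2 ^ 2) := by
    rw [h1, one_mul]
  rw [this]
  nlinarith [sq_nonneg (a * u 1 - b * u 0), sq_nonneg (a * u 2 - c * u 0),
    sq_nonneg (b * u 2 - c * u 1)]

lemma aux_qf_meas (v : E3) : Measurable (qf v) := by unfold qf; fun_prop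

lemma aux_qf_eq (v w : E3) (hv : ‖v‖ ≠ 0) :
    qf v (v - w) = ‖w‖ ^ 2 - (∑ i, v i / ‖v‖ * w i) ^ 2 := by
  have h1 := aux_unit v hv
  have h0 : ∀ i, v i = ‖v‖ * (v i / ‖v‖) := fun i => by field_simp
  unfold qf
  rw [aux_norm_sq, aux_norm_sq, Fin.sum_univ_three, Fin.sum_univ_three]
  simp only [PiLp.sub_apply]
  have k0 := h0 0
  have k1 := h0 1
  have k2 := h0 2
  generalize v 0 / ‖v‖ = a at *
  generalize v 1 / ‖v‖ = b at *
  generalize v 2 / ‖v‖ = c at *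
  rw [k0, k1, k2]
  have hc : c ^ 2 = 1 - a ^ 2 - b ^ 2 := by linarith
  generalize ‖v‖ = r at *
  have e1 : a * (r * a - w 0) + b * (r * b - w 1) + c * (r * c - w 2)
    = r - (a * w 0 + b * w 1 + c * w 2) := by linear_combination r * h1
  rw [e1]
  linear_combination r ^ 2 * h1

lemma aux_pt1 (γ : ℝ) (hγ0 : 0 ≤ γ) (v w : E3) (hv : ‖v‖ ≠ 0) :
    (1 - (∑ i, (v i / ‖v‖) * (w i / ‖w‖)) ^ 2) * ‖w‖ ^ (γ + 2) = qf v (v - w) * ‖w‖ ^ γ := by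
  rw [aux_qf_eq v w hv]
  by_cases hw : ‖w‖ = 0
  · have : w = 0 := norm_eq_zero.1 hw
    subst this
    rw [norm_zero, Real.zero_rpow (by linarith)]
    simp
  · have hp : 0 < ‖w‖ := lt_of_le_of_ne (norm_nonneg _) (Ne.symm hw)
    rw [Real.rpow_add hp, Real.rpow_two]
    have : (∑ i, (v i / ‖v‖) * (w i / ‖w‖)) = (∑ i, v i / ‖v‖ * w i) / ‖w‖ := by
      rw [Finset.sum_div]; congr 1; ext i; ring
    rw [this]
    field_simp

lemma aux_pt2 (γ : ℝ) (hγ0 : 0 ≤ γ) (v w : E3) (hv : ‖v‖ ≠ 0) :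
    (1 - (1 / 2) * crossSq (fun i => v i / ‖v‖) (fun i => w i / ‖w‖)) * ‖w‖ ^ (γ + 2)
      = ‖w‖ ^ (γ + 2) - 1 / 2 * (qf v (v - w) * ‖w‖ ^ γ) := by
  rw [← aux_pt1 γ hγ0 v w hv]
  by_cases hw : ‖w‖ = 0
  · rw [hw, Real.zero_rpow (by linarith)]
    simp
  · have h1 := aux_unit v hv
    have h2 := aux_unit w hw
    have : crossSq (fun i => v i / ‖v‖) (fun i => w i / ‖w‖)
        = 1 - (∑ i, (v i / ‖v‖) * (w i / ‖w‖)) ^ 2 := by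
      simp only [crossSq]
      rw [Fin.sum_univ_three]
      generalize v 0 / ‖v‖ = a at *
      generalize v 1 / ‖v‖ = b at *
      generalize v 2 / ‖v‖ = c at *
      generalize w 0 / ‖w‖ = x at *
      generalize w 1 / ‖w‖ = y at *
      generalize w 2 / ‖w‖ = z at *
      linear_combination (x ^ 2 + y ^ 2 + z ^ 2) * h1 + h2
    rw [this]; ring

lemma aux_rpow (γ t : ℝ) (hγ0 : 0 ≤ γ) (hγ1 : γ ≤ 1) (ht : 0 ≤ t) : |t ^ γ - 1| ≤ |t - 1| := by
  rcases le_total 1 t with h | h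
  · have a := Real.one_le_rpow h hγ0
    have b := Real.rpow_le_rpow_of_exponent_le h hγ1
    rw [Real.rpow_one] at b
    rw [abs_of_nonneg (by linarith), abs_of_nonneg (by linarith)]; linarith
  · have a := Real.rpow_le_one ht h hγ0
    have b : t ≤ t ^ γ := by
      rcases ht.eq_or_lt with h0 | h0
      · rw [← h0]; positivity
      · have := Real.rpow_le_rpow_of_exponent_ge h0 h hγ1
        rwa [Real.rpow_one] at this
    rw [abs_of_nonpos (by linarith), abs_of_nonpos (by linarith)]; linarith

lemma aux_ratio (v u : E3) (hv : 0 < ‖v‖) : |‖v - u‖ / ‖v‖ - 1| ≤ ‖u‖ / ‖v‖ := by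
  have h := abs_norm_sub_norm_le (v - u) v
  rw [show v - u - v = -u by abel, norm_neg] at h
  rw [div_sub_one hv.ne', abs_div, abs_of_pos hv]
  gcongr

lemma aux_ell1 (γ : ℝ) (hγ0 : 0 ≤ γ) (v : E3) (hv : 0 < ‖v‖) :
    ell1 γ v / ‖v‖ ^ γ = ∫ u, (qf v u * (‖v - u‖ / ‖v‖) ^ γ) * gauss u := by
  unfold ell1
  rw [← integral_div, ← integral_sub_left_eq_self _ _ v]
  congr 1; ext u
  rw [aux_pt1 γ hγ0 v _ hv.ne', sub_sub_cancel, Real.div_rpow (norm_nonneg _) (norm_nonneg _)]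
  ring

lemma aux_ell2 (γ : ℝ) (hγ0 : 0 ≤ γ) (v : E3) (hv : 0 < ‖v‖) :
    ell2 γ v / ‖v‖ ^ (γ + 2) = ∫ u, ((‖v - u‖ / ‖v‖) ^ (γ + 2)
      - 1 / 2 * (qf v u * (‖v - u‖ / ‖v‖) ^ γ) / ‖v‖ ^ 2) * gauss u := by
  unfold ell2
  rw [← integral_div, ← integral_sub_left_eq_self _ _ v]
  congr 1; ext u
  rw [aux_pt2 γ hγ0 v _ hv.ne', sub_sub_cancel, Real.div_rpow (norm_nonneg _) (norm_nonneg _),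
    Real.div_rpow (norm_nonneg _) (norm_nonneg _), Real.rpow_add hv, Real.rpow_two]
  have : ‖v‖ ^ γ ≠ 0 := (Real.rpow_pos_of_pos hv _).ne'
  field_simp

lemma aux_b1 (γ : ℝ) (hγ0 : 0 ≤ γ) (hγ1 : γ ≤ 1) (v : E3) (hv : 1 ≤ ‖v‖) :
    |ell1 γ v / ‖v‖ ^ γ - 2| ≤ 10 / ‖v‖ * ∫ u : E3, (1 + ‖u‖ ^ 4) * gauss u := by
  have hp : 0 < ‖v‖ := by linarith
  rw [aux_ell1 γ hγ0 v hp, ← aux_qf_int v hp.ne']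
  have := aux_qf_meas v
  refine aux_diff (by fun_prop) this _ 1 (fun u => ?_) (fun u => ?_)
  · obtain ⟨a, b⟩ := aux_qf_bd v u hp.ne'
    rw [abs_of_nonneg a]; linarith [aux_pow2 ‖u‖]
  · obtain ⟨a, b⟩ := aux_qf_bd v u hp.ne'
    rw [← mul_sub_one, abs_mul, abs_of_nonneg a]
    calc qf v u * |(‖v - u‖ / ‖v‖) ^ γ - 1| ≤ ‖u‖ ^ 2 * (‖u‖ / ‖v‖) := by
          gcongr
          exact (aux_rpow γ _ hγ0 hγ1 (by positivity)).trans (aux_ratio v u hp)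
      _ = ‖u‖ ^ 3 / ‖v‖ := by ring
      _ ≤ 10 * (1 + ‖u‖ ^ 4) / ‖v‖ := by
          gcongr
          nlinarith [sq_nonneg (‖u‖ ^ 2 - ‖u‖), aux_pow2 ‖u‖, sq_nonneg (‖u‖ ^ 2)]
      _ = _ := by ring

lemma aux_b2 (γ : ℝ) (hγ0 : 0 ≤ γ) (hγ1 : γ ≤ 1) (v : E3) (hv : 1 ≤ ‖v‖) :
    |ell2 γ v / ‖v‖ ^ (γ + 2) - 1| ≤ 100 / ‖v‖ * ∫ u : E3, (1 + ‖u‖ ^ 4) * gauss u := by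
  have hp : 0 < ‖v‖ := by linarith
  have h1 : ∫ u : E3, (1 : ℝ) * gauss u = 1 := by
    have := aux_moment (fun _ => 0)
    rw [aux_m0] at this
    simpa using this
  rw [aux_ell2 γ hγ0 v hp]
  nth_rw 2 [← h1]
  have := aux_qf_meas v
  refine aux_diff (by fun_prop) measurable_const _ 1 (fun u => ?_) (fun u => ?_)
  · rw [abs_one]; nlinarith [pow_nonneg (norm_nonneg u) 4]
  · obtain ⟨a, b⟩ := aux_qf_bd v u hp.ne'
    have ht : 0 ≤ ‖v - u‖ / ‖v‖ := by positivity
    have hr := aux_ratio v u hp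
    have hg := (aux_rpow γ _ hγ0 hγ1 ht).trans hr
    have hs : ‖u‖ / ‖v‖ ≤ ‖u‖ := div_le_self (norm_nonneg _) hv
    have hs0 : 0 ≤ ‖u‖ / ‖v‖ := by positivity
    have hq : qf v u / ‖v‖ ^ 2 ≤ (‖u‖ / ‖v‖) ^ 2 := by
      rw [div_pow]; gcongr
    have hq0 : 0 ≤ qf v u / ‖v‖ ^ 2 := by positivity
    rw [Real.rpow_add_of_nonneg ht hγ0 (by norm_num), Real.rpow_two]
    have hC : 100 / ‖v‖ * (1 + ‖u‖ ^ 4) = 100 * ((1 + ‖u‖ ^ 4) / ‖v‖) := by ring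
    have k : ∀ n : ℕ, n ≤ 3 → ‖u‖ ^ n * (‖u‖ / ‖v‖) ≤ 2 * ((1 + ‖u‖ ^ 4) / ‖v‖) := by
      intro n hn
      rw [← mul_div_assoc, ← mul_div_assoc]
      refine div_le_div_of_nonneg_right ?_ hp.le
      rw [← pow_succ]
      have hu := norm_nonneg u
      interval_cases n <;> norm_num <;>
        nlinarith [sq_nonneg (‖u‖ ^ 2 - ‖u‖), aux_pow2 ‖u‖, sq_nonneg (‖u‖ ^ 2),
          sq_nonneg (‖u‖ - 1)]
    have k0 := k 0 (by norm_num)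
    have k1 := k 1 (by norm_num)
    have k2 := k 2 (by norm_num)
    rw [hC]
    have hu := norm_nonneg u
    generalize (1 + ‖u‖ ^ 4) / ‖v‖ = M at *
    rw [show 1 / 2 * (qf v u * (‖v - u‖ / ‖v‖) ^ γ) / ‖v‖ ^ 2
      = 1 / 2 * (qf v u / ‖v‖ ^ 2) * (‖v - u‖ / ‖v‖) ^ γ by ring]
    generalize (‖v - u‖ / ‖v‖) ^ γ = G at *
    generalize ‖v - u‖ / ‖v‖ = t at *
    generalize qf v u / ‖v‖ ^ 2 = Q at *
    generalize ‖u‖ / ‖v‖ = s at *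
    generalize ‖u‖ = r at *
    have ht1 : t ≤ 1 + s := by linarith [(abs_le.1 hr).2]
    have hG1 : |G| ≤ 1 + s := by
      have := abs_add_le (G - 1) 1
      rw [sub_add_cancel, abs_one] at this; linarith
    have e1 : |(G - 1) * t ^ 2| ≤ s * (1 + s) ^ 2 := by
      rw [abs_mul, abs_of_nonneg (sq_nonneg t)]; gcongr
    have e2 : |(t - 1) * (t + 1)| ≤ s * (2 + s) := by
      rw [abs_mul, abs_of_nonneg (by linarith : 0 ≤ t + 1)]
      exact mul_le_mul hr (by linarith) (by linarith) hs0
    have e3 : |1 / 2 * Q * G| ≤ s ^ 2 * (1 + s) := by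
      rw [abs_mul, abs_of_nonneg (by linarith : 0 ≤ 1 / 2 * Q)]
      exact mul_le_mul (by linarith) hG1 (abs_nonneg _) (sq_nonneg s)
    have e4 : |G * t ^ 2 - 1 / 2 * Q * G - 1| ≤ s * (1 + s) ^ 2 + s * (2 + s) + s ^ 2 * (1 + s) := by
      rw [show G * t ^ 2 - 1 / 2 * Q * G - 1
        = (G - 1) * t ^ 2 + (t - 1) * (t + 1) - 1 / 2 * Q * G by ring]
      rw [abs_le] at *
      constructor <;> linarith
    have f1 : s * s ≤ r * s := mul_le_mul_of_nonneg_right hs hs0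
    have f2 : s ^ 2 * s ≤ r ^ 2 * s := by gcongr
    rw [pow_zero, one_mul] at k0
    rw [pow_one] at k1
    nlinarith

lemma aux_lim {f : E3 → ℝ} {L C : ℝ} (h : ∀ v : E3, 1 ≤ ‖v‖ → |f v - L| ≤ C / ‖v‖) :
    Tendsto f (comap (fun v : E3 => ‖v‖) atTop) (nhds L) := by
  rw [tendsto_iff_norm_sub_tendsto_zero]
  have ht : Tendsto (fun v : E3 => ‖v‖) (comap (fun v : E3 => ‖v‖) atTop) atTop := tendsto_comap
  refine squeeze_zero' (Eventually.of_forall fun _ => norm_nonneg _) ?_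
    (ht.const_div_atTop C)
  filter_upwards [ht.eventually_ge_atTop 1] with v hv
  exact h v hv

/-- As `|v| → ∞`, `ℓ₁(v) ∼ 2 |v|^γ` and `ℓ₂(v) ∼ |v|^{γ+2}`. -/
theorem stmt5 (γ : ℝ) (hγ0 : 0 ≤ γ) (hγ1 : γ ≤ 1) :
    Tendsto (fun v : E3 => ell1 γ v / ‖v‖ ^ γ)
      (comap (fun v : E3 => ‖v‖) atTop) (nhds 2) ∧
    Tendsto (fun v : E3 => ell2 γ v / ‖v‖ ^ (γ + 2))
      (comap (fun v : E3 => ‖v‖) atTop) (nhds 1) := by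
  refine ⟨aux_lim (C := 10 * ∫ u : E3, (1 + ‖u‖ ^ 4) * gauss u) fun v hv => ?_,
    aux_lim (C := 100 * ∫ u : E3, (1 + ‖u‖ ^ 4) * gauss u) fun v hv => ?_⟩
  · refine (aux_b1 γ hγ0 hγ1 v hv).trans_eq (by ring)
  · refine (aux_b2 γ hγ0 hγ1 v hv).trans_eq (by ring)
end
end

section
/- Let γ ∈ [0,1] and let β ∈ ℕ³ be a multi-index with |β| ≤ 2 (so that γ+2−|β| ≥ 0). There exists a constant C > 0 such that for every g ∈ L¹(⟨v⟩^{γ+2−|β|}), every v ∈ ℝ³ and all i,j ∈ {1,2,3}: |∂^β(a_{ij} * g)(v)| ≤ C ⟨v⟩^{γ+2−|β|} ∫_{ℝ³} |g(w)| ⟨w⟩^{γ+2−|β|} dw. -/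
open MeasureTheory Real Filter

noncomputable section

/-- The partial derivative `∂_i f` in the `i`-th coordinate direction. -/
def pd (i : Fin 3) (f : E3 → ℝ) : E3 → ℝ :=
  fun v => fderiv ℝ f v (EuclideanSpace.single i 1)

/-- The multi-index derivative `∂^β f` for `β ∈ ℕ³`. -/
def multiDeriv (β : Fin 3 → ℕ) (f : E3 → ℝ) : E3 → ℝ :=
  (pd 0)^[β 0] ((pd 1)^[β 1] ((pd 2)^[β 2] f))

/-- The weight `⟨v⟩ = (1 + |v|²)^{1/2}`. -/
def jap (v : E3) : ℝ := Real.sqrt (1 + ‖v‖ ^ 2)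

/-- Angular part of the derivative of the kernel. -/
def Hk (γ : ℝ) (i j : Fin 3) (u : E3) : E3 →L[ℝ] ℝ :=
  ((γ + 2) * ((if i = j then (1 : ℝ) else 0) - u i * u j) + 2 * (u i * u j)) • innerSL ℝ u
    - (u i • (EuclideanSpace.proj j : E3 →L[ℝ] ℝ) + u j • (EuclideanSpace.proj i : E3 →L[ℝ] ℝ))

/-- The derivative of the kernel. -/
def bk (γ : ℝ) (i j : Fin 3) (z : E3) : E3 →L[ℝ] ℝ :=
  ‖z‖ ^ (γ + 1) • Hk γ i j (‖z‖⁻¹ • z)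

lemma coord_le (z : E3) (i : Fin 3) : |z i| ≤ ‖z‖ := by
  simpa using PiLp.norm_apply_le z i

lemma contDiff_Hk (γ : ℝ) (i j : Fin 3) : ContDiff ℝ 1 (Hk γ i j) := by
  have hp : ∀ k : Fin 3, ContDiff ℝ 1 (fun u : E3 => u k) := fun k =>
    (EuclideanSpace.proj k : E3 →L[ℝ] ℝ).contDiff
  have hi : ContDiff ℝ 1 (fun u : E3 => (innerSL ℝ u : E3 →L[ℝ] ℝ)) := (innerSL ℝ).contDiff
  have h1 := hp i
  have h2 := hp j
  unfold Hk
  fun_prop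

lemma norm_u_le (z : E3) : ‖‖z‖⁻¹ • z‖ ≤ 1 := by
  rw [norm_smul, norm_inv, norm_norm]
  exact inv_mul_le_one

lemma norm_smul_u (z : E3) : ‖z‖ • (‖z‖⁻¹ • z) = z := by
  by_cases h : z = 0
  · simp [h]
  · rw [smul_smul, mul_inv_cancel₀ (norm_ne_zero_iff.2 h), one_smul]

lemma u_lip (x y : E3) : ‖x‖ * ‖‖x‖⁻¹ • x - ‖y‖⁻¹ • y‖ ≤ 2 * ‖x - y‖ := by
  have e : ‖x‖ • (‖x‖⁻¹ • x - ‖y‖⁻¹ • y) = (x - y) - (‖x‖ - ‖y‖) • (‖y‖⁻¹ • y) := by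
    rw [smul_sub, norm_smul_u, sub_smul, norm_smul_u]; abel
  have e2 : ‖x‖ * ‖‖x‖⁻¹ • x - ‖y‖⁻¹ • y‖ = ‖(x - y) - (‖x‖ - ‖y‖) • (‖y‖⁻¹ • y)‖ := by
    rw [← e, norm_smul, norm_norm]
  rw [e2]
  refine (norm_sub_le _ _).trans ?_
  rw [norm_smul, Real.norm_eq_abs]
  have h1 := abs_norm_sub_norm_le x y
  have h2 := norm_u_le y
  nlinarith [abs_nonneg (‖x‖ - ‖y‖), norm_nonneg (‖y‖⁻¹ • y)]

lemma rpow_diff {γ r q : ℝ} (hγ0 : 0 ≤ γ) (hγ1 : γ ≤ 1) (hr : 0 < r) (hq : 0 ≤ q) (h : q ≤ r) :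
    r ^ (γ + 1) - q ^ (γ + 1) ≤ 2 * r ^ γ * (r - q) := by
  have hb := one_add_mul_self_le_rpow_one_add (s := q / r - 1) (p := γ + 1)
    (by have := div_nonneg hq hr.le; linarith) (by linarith)
  have e1 : (1 + (q / r - 1)) ^ (γ + 1) = q ^ (γ + 1) / r ^ (γ + 1) := by
    rw [← Real.div_rpow hq hr.le]; congr 1; ring
  rw [e1, le_div_iff₀ (by positivity), Real.rpow_add hr, Real.rpow_one] at hb
  rw [Real.rpow_add hr, Real.rpow_one]
  have e2 : (1 + (γ + 1) * (q / r - 1)) * (r ^ γ * r) = r ^ γ * (r + (γ + 1) * (q - r)) := by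
    field_simp
  rw [e2] at hb
  have : 0 ≤ r ^ γ * ((1 - γ) * (r - q)) := by
    have := sub_nonneg.2 h
    have := sub_nonneg.2 hγ1
    positivity
  nlinarith

lemma Hk_bounds (γ : ℝ) (i j : Fin 3) : ∃ M : ℝ, 0 ≤ M ∧
    (∀ u : E3, ‖u‖ ≤ 1 → ‖Hk γ i j u‖ ≤ M) ∧
    (∀ u v : E3, ‖u‖ ≤ 1 → ‖v‖ ≤ 1 → ‖Hk γ i j u - Hk γ i j v‖ ≤ M * ‖u - v‖) := by
  have hc : IsCompact (Metric.closedBall (0 : E3) 1) := isCompact_closedBall _ _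
  obtain ⟨K, hK⟩ := (contDiff_Hk γ i j).contDiffOn.exists_lipschitzOnWith (s := Metric.closedBall (0 : E3) 1)
    one_ne_zero (convex_closedBall _ _) hc
  obtain ⟨M, hM⟩ := hc.exists_bound_of_continuousOn (contDiff_Hk γ i j).continuous.continuousOn
  refine ⟨max M K, le_max_of_le_right K.2, fun u hu => (hM u (by simpa using hu)).trans (le_max_left _ _),
    fun u v hu hv => ?_⟩
  refine (hK.norm_sub_le (by simpa using hu) (by simpa using hv)).trans ?_
  gcongr
  exact le_max_right _ _

lemma bk_bounds (γ : ℝ) (hγ0 : 0 ≤ γ) (hγ1 : γ ≤ 1) (i j : Fin 3) : ∃ M : ℝ, 0 ≤ M ∧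
    (∀ z : E3, ‖bk γ i j z‖ ≤ M * ‖z‖ ^ (γ + 1)) ∧
    (∀ x y : E3, ‖bk γ i j x - bk γ i j y‖ ≤ M * ‖x - y‖ * (‖x‖ + ‖y‖) ^ γ) := by
  obtain ⟨M, hM0, hM1, hM2⟩ := Hk_bounds γ i j
  refine ⟨4 * M, by positivity, fun z => ?_, ?_⟩
  · unfold bk
    rw [norm_smul, Real.norm_eq_abs, abs_of_nonneg (by positivity)]
    have := hM1 _ (norm_u_le z)
    have h0 : 0 ≤ ‖z‖ ^ (γ + 1) := by positivity
    nlinarith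
  · have key : ∀ x y : E3, ‖y‖ ≤ ‖x‖ → ‖bk γ i j x - bk γ i j y‖ ≤ 4 * M * ‖x - y‖ * (‖x‖ + ‖y‖) ^ γ := by
      intro x y hxy
      by_cases hx : x = 0
      · have hy : y = 0 := by
          rw [hx, norm_zero] at hxy
          exact norm_le_zero_iff.1 hxy
        simp [hx, hy]
      have hr : 0 < ‖x‖ := norm_pos_iff.2 hx
      set ux := ‖x‖⁻¹ • x with hux
      set uy := ‖y‖⁻¹ • y with huy
      have e : bk γ i j x - bk γ i j y = (‖x‖ ^ (γ + 1) - ‖y‖ ^ (γ + 1)) • Hk γ i j ux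
          + ‖y‖ ^ (γ + 1) • (Hk γ i j ux - Hk γ i j uy) := by
        unfold bk
        rw [← hux, ← huy]
        module
      have hmono : ‖y‖ ^ (γ + 1) ≤ ‖x‖ ^ (γ + 1) := by gcongr
      have hd := rpow_diff hγ0 hγ1 hr (norm_nonneg y) hxy
      have h1 : ‖(‖x‖ ^ (γ + 1) - ‖y‖ ^ (γ + 1)) • Hk γ i j ux‖ ≤ 2 * ‖x‖ ^ γ * ‖x - y‖ * M := by
        rw [norm_smul, Real.norm_eq_abs, abs_of_nonneg (by linarith)]
        have hn := norm_sub_norm_le x y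
        have : ‖x‖ ^ (γ + 1) - ‖y‖ ^ (γ + 1) ≤ 2 * ‖x‖ ^ γ * ‖x - y‖ :=
          hd.trans (by gcongr)
        exact mul_le_mul this (hM1 _ (norm_u_le x)) (norm_nonneg _) (by positivity)
      have h2 : ‖‖y‖ ^ (γ + 1) • (Hk γ i j ux - Hk γ i j uy)‖ ≤ 2 * ‖x‖ ^ γ * ‖x - y‖ * M := by
        rw [norm_smul, Real.norm_eq_abs, abs_of_nonneg (by positivity)]
        calc ‖y‖ ^ (γ + 1) * ‖Hk γ i j ux - Hk γ i j uy‖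
            ≤ ‖x‖ ^ (γ + 1) * (M * ‖ux - uy‖) := by
              gcongr
              exact hM2 _ _ (norm_u_le x) (norm_u_le y)
          _ = ‖x‖ ^ γ * M * (‖x‖ * ‖ux - uy‖) := by
              rw [Real.rpow_add hr, Real.rpow_one]; ring
          _ ≤ ‖x‖ ^ γ * M * (2 * ‖x - y‖) := by
              exact mul_le_mul_of_nonneg_left (u_lip x y) (by positivity)
          _ = _ := by ring
      have h3 : ‖x‖ ^ γ ≤ (‖x‖ + ‖y‖) ^ γ := by
        gcongr
        linarith [norm_nonneg y]
      rw [e]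
      calc _ ≤ 2 * ‖x‖ ^ γ * ‖x - y‖ * M + 2 * ‖x‖ ^ γ * ‖x - y‖ * M := (norm_add_le _ _).trans (add_le_add h1 h2)
        _ = 4 * M * ‖x - y‖ * ‖x‖ ^ γ := by ring
        _ ≤ _ := by gcongr
    intro x y
    rcases le_total ‖y‖ ‖x‖ with h | h
    · exact key x y h
    · have := key y x h
      rwa [norm_sub_rev, norm_sub_rev y x, add_comm ‖y‖] at this

lemma amat_bound (γ : ℝ) (hγ0 : 0 ≤ γ) (z : E3) (i j : Fin 3) : |amat γ z i j| ≤ 2 * ‖z‖ ^ (γ + 2) := by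
  unfold amat
  rw [abs_mul, abs_of_nonneg (by positivity : 0 ≤ ‖z‖ ^ (γ + 2)), mul_comm]
  gcongr
  refine (abs_sub _ _).trans ?_
  have h1 : |(if i = j then (1 : ℝ) else 0)| ≤ 1 := by split_ifs <;> simp
  have h2 : |z i * z j / ‖z‖ ^ 2| ≤ 1 := by
    rw [abs_div, abs_mul, abs_of_nonneg (by positivity : 0 ≤ ‖z‖ ^ 2)]
    apply div_le_one_of_le₀ _ (by positivity)
    rw [sq]
    exact mul_le_mul (coord_le z i) (coord_le z j) (abs_nonneg _) (norm_nonneg _)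
  linarith

lemma amat_hasFDerivAt (γ : ℝ) (hγ0 : 0 ≤ γ) (z : E3) (i j : Fin 3) :
    HasFDerivAt (fun z => amat γ z i j) (bk γ i j z) z := by
  by_cases hz : z = 0
  · subst hz
    have : bk γ i j 0 = 0 := by
      unfold bk
      rw [norm_zero, Real.zero_rpow (by linarith), zero_smul]
    rw [this]
    refine Asymptotics.IsBigO.hasFDerivAt (n := 2) ?_ (by norm_num)
    refine Asymptotics.IsBigO.of_bound 2 ?_
    filter_upwards [Metric.ball_mem_nhds (0 : E3) one_pos] with x hx
    have hx1 : ‖x‖ < 1 := by simpa using hx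
    rw [sub_zero, Real.norm_eq_abs, norm_pow, norm_norm]
    refine (amat_bound γ hγ0 x i j).trans ?_
    gcongr
    rw [← Real.rpow_two]
    by_cases h : x = 0
    · simp [h, Real.zero_rpow (by linarith : γ + 2 ≠ 0)]
    exact Real.rpow_le_rpow_of_exponent_ge (norm_pos_iff.2 h) hx1.le (by linarith)
  · have hr : 0 < ‖z‖ := norm_pos_iff.2 hz
    have h1 := hasFDerivAt_norm_rpow z (p := γ + 2) (by linarith)
    have hp : ∀ k : Fin 3, HasFDerivAt (fun u : E3 => u k) (EuclideanSpace.proj k : E3 →L[ℝ] ℝ) z := fun k =>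
      (EuclideanSpace.proj k : E3 →L[ℝ] ℝ).hasFDerivAt
    have h2 : HasFDerivAt (fun x : E3 => ‖x‖ ^ 2) (2 • (innerSL ℝ z)) z := (hasStrictFDerivAt_norm_sq z).hasFDerivAt
    have h3 := h1.mul ((((hp i).mul (hp j)).mul ((hasDerivAt_inv (by positivity : ‖z‖ ^ 2 ≠ 0)).comp_hasFDerivAt z h2)).const_sub (if i = j then (1 : ℝ) else 0))
    refine (h3.congr_fderiv ?_)
    ext h
    unfold bk Hk
    have e1 : ‖z‖ ^ (γ + 2) = ‖z‖ ^ γ * ‖z‖ ^ 2 := by rw [Real.rpow_add hr, Real.rpow_two]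
    have e2 : ‖z‖ ^ (γ + 1) = ‖z‖ ^ γ * ‖z‖ := by rw [Real.rpow_add hr, Real.rpow_one]
    have e3 : ‖z‖ ^ (γ + 2 - 2) = ‖z‖ ^ γ := by congr 1; ring
    simp [e1, e2, e3]
    field_simp
    ring

lemma amat_kernel (γ : ℝ) (hγ0 : 0 ≤ γ) (hγ1 : γ ≤ 1) (i j : Fin 3) : ∃ M : ℝ, 0 ≤ M ∧
    (∀ z, |amat γ z i j| ≤ M * ‖z‖ ^ (γ + 2)) ∧
    (∀ x y, |amat γ y i j - amat γ x i j| ≤ M * ‖y - x‖ * (‖x‖ + ‖y‖) ^ (γ + 1)) ∧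
    (∀ x y : E3, ‖bk γ i j y - bk γ i j x‖ ≤ M * ‖y - x‖ * (‖x‖ + ‖y‖) ^ γ) ∧
    (∀ x y : E3, |amat γ y i j - amat γ x i j - bk γ i j x (y - x)| ≤ M * ‖y - x‖ ^ 2 * (‖x‖ + ‖y‖) ^ γ) := by
  obtain ⟨M, hM0, hM1, hM2⟩ := bk_bounds γ hγ0 hγ1 i j
  have seg : ∀ x y z : E3, z ∈ segment ℝ x y → ‖z‖ ≤ ‖x‖ + ‖y‖ := by
    intro x y z hz
    obtain ⟨s, t, hs, ht, hst, rfl⟩ := hz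
    refine (norm_add_le _ _).trans ?_
    rw [norm_smul, norm_smul, Real.norm_of_nonneg hs, Real.norm_of_nonneg ht]
    nlinarith [norm_nonneg x, norm_nonneg y]
  have seg2 : ∀ x y z : E3, z ∈ segment ℝ x y → ‖z - x‖ ≤ ‖y - x‖ := by
    intro x y z hz
    obtain ⟨s, t, hs, ht, hst, rfl⟩ := hz
    have : s • x + t • y - x = t • (y - x) := by
      rw [show s = 1 - t by linarith]; module
    rw [this, norm_smul, Real.norm_of_nonneg ht]
    nlinarith [norm_nonneg (y - x)]
  refine ⟨2 * M + 2, by positivity, fun z => ?_, fun x y => ?_, fun x y => ?_, fun x y => ?_⟩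
  · refine (amat_bound γ hγ0 z i j).trans ?_
    gcongr
    linarith
  · have := Convex.norm_image_sub_le_of_norm_hasFDerivWithin_le (s := segment ℝ x y)
      (f := fun z => amat γ z i j) (f' := bk γ i j) (C := M * (‖x‖ + ‖y‖) ^ (γ + 1))
      (fun z _ => (amat_hasFDerivAt γ hγ0 z i j).hasFDerivWithinAt)
      (fun z hz => (hM1 z).trans (by gcongr; exact seg x y z hz)) (convex_segment _ _)
      (left_mem_segment ℝ x y) (right_mem_segment ℝ x y)
    rw [Real.norm_eq_abs] at this
    refine this.trans ?_
    rw [mul_right_comm]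
    gcongr
    linarith
  · refine (hM2 y x).trans ?_
    rw [add_comm ‖y‖]
    gcongr
    linarith
  · have := Convex.norm_image_sub_le_of_norm_hasFDerivWithin_le' (s := segment ℝ x y)
      (f := fun z => amat γ z i j) (f' := bk γ i j) (φ := bk γ i j x) (C := M * ‖y - x‖ * (2 * (‖x‖ + ‖y‖)) ^ γ)
      (fun z _ => (amat_hasFDerivAt γ hγ0 z i j).hasFDerivWithinAt)
      (fun z hz => (hM2 z x).trans (by
        have := seg x y z hz
        have := seg2 x y z hz
        gcongr
        linarith [norm_nonneg y])) (convex_segment _ _)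
      (left_mem_segment ℝ x y) (right_mem_segment ℝ x y)
    rw [Real.norm_eq_abs] at this
    refine this.trans ?_
    rw [Real.mul_rpow (by norm_num) (by positivity)]
    have h2 : (2 : ℝ) ^ γ ≤ 2 := by
      simpa using Real.rpow_le_rpow_of_exponent_le (x := 2) (by norm_num) hγ1
    calc _ = (2 : ℝ) ^ γ * (M * ‖y - x‖ ^ 2 * (‖x‖ + ‖y‖) ^ γ) := by ring
      _ ≤ 2 * (M * ‖y - x‖ ^ 2 * (‖x‖ + ‖y‖) ^ γ) := by gcongr
      _ = (2 * M) * ‖y - x‖ ^ 2 * (‖x‖ + ‖y‖) ^ γ := by ring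
      _ ≤ _ := by gcongr; linarith

lemma one_le_jap (v : E3) : 1 ≤ jap v := by
  unfold jap
  rw [Real.one_le_sqrt]
  nlinarith [sq_nonneg ‖v‖]

lemma norm_le_jap (v : E3) : ‖v‖ ≤ jap v := by
  unfold jap
  exact Real.le_sqrt_of_sq_le (by linarith)

lemma jap_le (v : E3) : jap v ≤ 1 + ‖v‖ := by
  unfold jap
  rw [Real.sqrt_le_left (by positivity)]
  nlinarith [norm_nonneg v]

lemma norm_sub_le_jap (x w : E3) : ‖x - w‖ ≤ 2 * jap x * jap w := by
  have := norm_sub_le x w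
  nlinarith [norm_le_jap x, norm_le_jap w, one_le_jap x, one_le_jap w]

lemma weight_le {p : ℝ} (hp : 0 ≤ p) (x y w : E3) :
    (‖x - w‖ + ‖y - w‖) ^ p ≤ (2 * (jap x + jap y)) ^ p * jap w ^ p := by
  have h1 := one_le_jap x
  have h2 := one_le_jap y
  have h3 := one_le_jap w
  rw [← Real.mul_rpow (by positivity) (by positivity)]
  apply Real.rpow_le_rpow (by positivity) _ hp
  linarith [norm_sub_le_jap x w, norm_sub_le_jap y w]

lemma near_weight {p : ℝ} (hp : 0 ≤ p) (x y : E3) (h : ‖y - x‖ ≤ 1) :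
    (2 * (jap x + jap y)) ^ p ≤ 6 ^ p * jap x ^ p := by
  have h1 := one_le_jap x
  have h2 := one_le_jap y
  rw [← Real.mul_rpow (by positivity) (by positivity)]
  apply Real.rpow_le_rpow (by positivity) _ hp
  have : jap y ≤ jap x + ‖y - x‖ := by
    unfold jap
    rw [Real.sqrt_le_left (by positivity)]
    have e := Real.sq_sqrt (by positivity : 0 ≤ 1 + ‖x‖ ^ 2)
    have hx : ‖x‖ ≤ √(1 + ‖x‖ ^ 2) := norm_le_jap x
    have hy : ‖y‖ ≤ ‖x‖ + ‖y - x‖ := by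
      have := norm_add_le x (y - x)
      rwa [add_sub_cancel] at this
    nlinarith [norm_nonneg y, norm_nonneg x, norm_nonneg (y - x)]
  linarith

section conv

variable {g : E3 → ℝ} {p : ℝ}

lemma dom_bound (hp : 0 ≤ p) (hg : Integrable (fun w : E3 => |g w| * jap w ^ p)) (f : E3 → ℝ)
    (x y : E3) {c : ℝ} (hc : 0 ≤ c) (hf : ∀ w, |f w| ≤ c * (‖x - w‖ + ‖y - w‖) ^ p * |g w|) :
    |∫ w, f w| ≤ c * (2 * (jap x + jap y)) ^ p * ∫ w : E3, |g w| * jap w ^ p := by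
  rw [← integral_const_mul, ← Real.norm_eq_abs]
  refine norm_integral_le_of_norm_le (hg.const_mul _) (Eventually.of_forall fun w => ?_)
  refine (hf w).trans ?_
  calc _ ≤ c * ((2 * (jap x + jap y)) ^ p * jap w ^ p) * |g w| := by
        gcongr
        exact weight_le hp x y w
    _ = _ := by ring

lemma dom_integrable (hp : 0 ≤ p) (hg : Integrable (fun w : E3 => |g w| * jap w ^ p)) (f : E3 → ℝ)
    (hm : AEStronglyMeasurable f)
    (x y : E3) {c : ℝ} (hc : 0 ≤ c) (hf : ∀ w, |f w| ≤ c * (‖x - w‖ + ‖y - w‖) ^ p * |g w|) :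
    Integrable f := by
  refine (hg.const_mul (c * (2 * (jap x + jap y)) ^ p)).mono' hm (Eventually.of_forall fun w => ?_)
  refine (hf w).trans ?_
  calc _ ≤ c * ((2 * (jap x + jap y)) ^ p * jap w ^ p) * |g w| := by
        gcongr
        exact weight_le hp x y w
    _ = _ := by ring

variable {K : E3 → ℝ} {b : E3 → E3 →L[ℝ] ℝ} {M : ℝ}

lemma case_zero (hp : 0 ≤ p) (hM : 0 ≤ M) (h0 : ∀ z, |K z| ≤ M * ‖z‖ ^ p)
    (hg : Integrable (fun w : E3 => |g w| * jap w ^ p)) (v : E3) :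
    |∫ w, K (v - w) * g w| ≤ M * 6 ^ p * jap v ^ p * ∫ w : E3, |g w| * jap w ^ p := by
  have hI : 0 ≤ ∫ w : E3, |g w| * jap w ^ p :=
    integral_nonneg fun w => mul_nonneg (abs_nonneg _) (Real.rpow_nonneg (Real.sqrt_nonneg _) _)
  refine (dom_bound hp hg _ v v hM fun w => ?_).trans ?_
  · rw [abs_mul]
    gcongr
    refine (h0 _).trans ?_
    gcongr
    linarith [norm_nonneg (v - w)]
  · rw [mul_assoc M (6 ^ p)]
    gcongr
    exact near_weight hp v v (by simp)

lemma diff_bound (hp : 0 ≤ p) (hM : 0 ≤ M)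
    (h1 : ∀ x y, |K y - K x| ≤ M * ‖y - x‖ * (‖x‖ + ‖y‖) ^ p)
    (hg : Integrable (fun w : E3 => |g w| * jap w ^ p))
    (hall : ∀ v, Integrable (fun w => K (v - w) * g w)) (v y : E3) (hy : ‖y - v‖ ≤ 1) :
    |(∫ w, K (y - w) * g w) - ∫ w, K (v - w) * g w| ≤
      (M * 6 ^ p * jap v ^ p * ∫ w : E3, |g w| * jap w ^ p) * ‖y - v‖ := by
  have hI : 0 ≤ ∫ w : E3, |g w| * jap w ^ p :=
    integral_nonneg fun w => mul_nonneg (abs_nonneg _) (Real.rpow_nonneg (Real.sqrt_nonneg _) _)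
  rw [← integral_sub (hall y) (hall v)]
  refine (dom_bound hp hg _ v y (c := M * ‖y - v‖) (by positivity) fun w => ?_).trans ?_
  · rw [← sub_mul, abs_mul]
    gcongr
    have := h1 (v - w) (y - w)
    rwa [sub_sub_sub_cancel_right] at this
  · calc _ ≤ M * ‖y - v‖ * (6 ^ p * jap v ^ p) * ∫ w : E3, |g w| * jap w ^ p := by
          gcongr
          exact near_weight hp v y hy
      _ = _ := by ring

lemma pd_bound (f : E3 → ℝ) (k : Fin 3) (v : E3) {c : ℝ} (hc : 0 ≤ c)
    (h : ∀ y, ‖y - v‖ ≤ 1 → |f y - f v| ≤ c * ‖y - v‖) : |pd k f v| ≤ c := by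
  have h1 : ‖fderiv ℝ f v‖ ≤ c := by
    apply norm_fderiv_le_of_lip' ℝ hc
    filter_upwards [Metric.ball_mem_nhds v one_pos] with y hy
    exact h y (by rw [← dist_eq_norm]; exact (Metric.mem_ball.1 hy).le)
  unfold pd
  have := (fderiv ℝ f v).le_opNorm (EuclideanSpace.single k 1)
  simpa using this.trans (by simpa using h1)

lemma pd_zero (k : Fin 3) : pd k (fun _ => 0) = fun _ => 0 := by
  funext v; simp [pd]

lemma case_one (hp : 0 ≤ p) (hM : 0 ≤ M) (hK : Continuous K)
    (h1 : ∀ x y, |K y - K x| ≤ M * ‖y - x‖ * (‖x‖ + ‖y‖) ^ p)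
    (hmeas : ∀ v, Integrable (fun w => K (v - w) * g w) → AEStronglyMeasurable g)
    (hg : Integrable (fun w : E3 => |g w| * jap w ^ p)) (k : Fin 3) (v : E3) :
    |pd k (fun v => ∫ w, K (v - w) * g w) v| ≤ M * 6 ^ p * jap v ^ p * ∫ w : E3, |g w| * jap w ^ p := by
  have hI : 0 ≤ ∫ w : E3, |g w| * jap w ^ p :=
    integral_nonneg fun w => mul_nonneg (abs_nonneg _) (Real.rpow_nonneg (Real.sqrt_nonneg _) _)
  have hj := one_le_jap v
  have hC : 0 ≤ M * 6 ^ p * jap v ^ p * ∫ w : E3, |g w| * jap w ^ p :=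
    mul_nonneg (by positivity) hI
  by_cases hex : ∃ x, Integrable (fun w => K (x - w) * g w)
  · obtain ⟨x, hx⟩ := hex
    have hgm := hmeas x hx
    have hall : ∀ y, Integrable (fun w => K (y - w) * g w) := by
      intro y
      have : Integrable (fun w => (K (y - w) - K (x - w)) * g w) := by
        refine dom_integrable hp hg _ ?_ x y (c := M * ‖y - x‖) (by positivity) fun w => ?_
        · exact (Continuous.aestronglyMeasurable (by fun_prop)).mul hgm
        · rw [abs_mul]
          gcongr
          have := h1 (x - w) (y - w)
          rwa [sub_sub_sub_cancel_right] at this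
      refine (this.add hx).congr (Eventually.of_forall fun w => ?_)
      simp only [Pi.add_apply]; ring
    exact pd_bound _ k v hC fun y hy => diff_bound hp hM h1 hg hall v y hy
  · push Not at hex
    have : (fun v => ∫ w, K (v - w) * g w) = fun _ => 0 := by
      funext x; exact integral_undef (hex x)
    rw [this, pd_zero]
    simpa using hC

/-- A function vanishing outside a proper affine set has zero derivative. -/
lemma fderiv_zero_of_affine (F : E3 → ℝ) (S : Set E3) (hF : ∀ x, x ∉ S → F x = 0)
    (hS : ∀ x ∈ S, ∀ y ∈ S, ∀ t : ℝ, x + t • (y - x) ∈ S) (v0 : E3) (hv0 : v0 ∉ S) (v : E3) :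
    fderiv ℝ F v = 0 := by
  by_cases hd : DifferentiableAt ℝ F v
  swap
  · exact fderiv_zero_of_not_differentiableAt hd
  have key : ∀ h : E3, (∃ t : ℝ, v + t • h ∉ S) → fderiv ℝ F v h = 0 := by
    rintro h ⟨t0, ht0⟩
    -- along the line, at most one parameter belongs to S
    have huniq : ∀ s t : ℝ, v + s • h ∈ S → v + t • h ∈ S → s = t := by
      intro s t hs ht
      by_contra hne
      apply ht0
      have := hS _ hs _ ht ((t0 - s) / (t - s))
      have hts : t - s ≠ 0 := sub_ne_zero.2 (Ne.symm hne)
      convert this using 1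
      rw [show v + t • h - (v + s • h) = (t - s) • h by module, smul_smul, div_mul_cancel₀ _ hts]
      module
    have hev : ∀ᶠ t in nhdsWithin (0 : ℝ) {0}ᶜ, F (v + t • h) = 0 := by
      by_cases hs : ∃ s : ℝ, s ≠ 0 ∧ v + s • h ∈ S
      · obtain ⟨s, hs0, hs⟩ := hs
        have : ∀ᶠ t in nhdsWithin (0 : ℝ) {0}ᶜ, t ≠ s :=
          nhdsWithin_le_nhds (isOpen_ne.mem_nhds hs0.symm)
        filter_upwards [this] with t ht
        exact hF _ fun hm => ht (huniq _ _ hm hs)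
      · push Not at hs
        filter_upwards [self_mem_nhdsWithin] with t ht
        exact hF _ (hs t ht)
    have hline : HasDerivAt (fun t : ℝ => F (v + t • h)) (fderiv ℝ F v h) 0 := by
      have h2 : HasDerivAt (fun t : ℝ => v + t • h) h 0 := by
        simpa using ((hasDerivAt_id (0 : ℝ)).smul_const h).const_add v
      have h1 : HasFDerivAt F (fderiv ℝ F v) (v + (0 : ℝ) • h) := by
        simpa using hd.hasFDerivAt
      exact h1.comp_hasDerivAt 0 h2
    have h0 : F (v + (0 : ℝ) • h) = 0 := by
      have ht : Tendsto (fun t : ℝ => F (v + t • h)) (nhdsWithin (0 : ℝ) {0}ᶜ) (nhds (F (v + (0 : ℝ) • h))) :=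
        hline.continuousAt.tendsto.mono_left nhdsWithin_le_nhds
      have ht2 : Tendsto (fun t : ℝ => F (v + t • h)) (nhdsWithin (0 : ℝ) {0}ᶜ) (nhds 0) :=
        tendsto_const_nhds.congr' (hev.mono fun t ht => ht.symm)
      exact tendsto_nhds_unique ht ht2
    have hev2 : (fun t : ℝ => F (v + t • h)) =ᶠ[nhds 0] fun _ => 0 := by
      filter_upwards [eventually_nhdsWithin_iff.1 hev] with t ht
      by_cases ht0 : t = 0
      · rw [ht0]; exact h0
      · exact ht ht0
    exact hline.unique ((hasDerivAt_const (0 : ℝ) (0 : ℝ)).congr_of_eventuallyEq hev2)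
  ext h
  by_cases hh : ∃ t : ℝ, v + t • h ∉ S
  · simpa using key h hh
  push Not at hh
  have k1 := key (v0 - v) ⟨1, by simpa using hv0⟩
  have k2 := key (h + (v0 - v)) ⟨1, fun hm => hv0 ?_⟩
  · rw [map_add, k1, add_zero] at k2
    simpa using k2
  · have m1 := hS _ hm _ (hh (-1)) (1 / 2)
    have m0 : v ∈ S := by simpa using hh 0
    have m2 := hS _ m0 _ m1 2
    convert m2 using 1
    module

set_option maxHeartbeats 1000000 in
lemma case_two (hp : 0 ≤ p) (hM : 0 ≤ M) (hK : Continuous K) (hb : Continuous b)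
    (h2 : ∀ x y, ‖b y - b x‖ ≤ M * ‖y - x‖ * (‖x‖ + ‖y‖) ^ p)
    (h3 : ∀ x y, |K y - K x - b x (y - x)| ≤ M * ‖y - x‖ ^ 2 * (‖x‖ + ‖y‖) ^ p)
    (hmeas : ∀ v, Integrable (fun w => K (v - w) * g w) → AEStronglyMeasurable g)
    (hg : Integrable (fun w : E3 => |g w| * jap w ^ p)) (k l : Fin 3) (v : E3) :
    |pd l (pd k (fun v => ∫ w, K (v - w) * g w)) v| ≤
      M * 6 ^ p * jap v ^ p * ∫ w : E3, |g w| * jap w ^ p := by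
  have hI : 0 ≤ ∫ w : E3, |g w| * jap w ^ p :=
    integral_nonneg fun w => mul_nonneg (abs_nonneg _) (Real.rpow_nonneg (Real.sqrt_nonneg _) _)
  have hj := one_le_jap v
  have hC : 0 ≤ M * 6 ^ p * jap v ^ p * ∫ w : E3, |g w| * jap w ^ p :=
    mul_nonneg (by positivity) hI
  have h3' : ∀ x y w : E3, |K (y - w) - K (x - w) - b (x - w) (y - x)| ≤
      M * ‖y - x‖ ^ 2 * (‖x - w‖ + ‖y - w‖) ^ p := fun x y w => by
    have := h3 (x - w) (y - w)
    rwa [sub_sub_sub_cancel_right] at this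
  -- the Taylor remainder is integrable
  have hT : AEStronglyMeasurable g → ∀ x y : E3,
      Integrable (fun w => (K (y - w) - K (x - w) - b (x - w) (y - x)) * g w) := by
    intro hgm x y
    refine dom_integrable hp hg _ ?_ x y (c := M * ‖y - x‖ ^ 2) (by positivity) fun w => ?_
    · exact (Continuous.aestronglyMeasurable (by fun_prop)).mul hgm
    · rw [abs_mul]
      gcongr
      exact h3' x y w
  by_cases hall : ∀ x, Integrable (fun w => K (x - w) * g w)
  · have hgm := hmeas 0 (hall 0)
    have hbi : ∀ x h : E3, Integrable (fun w => b (x - w) h * g w) := by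
      intro x h
      have := ((hall (x + h)).sub (hall x)).sub (hT hgm x (x + h))
      refine this.congr (Eventually.of_forall fun w => ?_)
      simp only [Pi.sub_apply, add_sub_cancel_left]; ring
    let L : E3 → E3 →L[ℝ] ℝ := fun x => LinearMap.toContinuousLinearMap
      { toFun := fun h => ∫ w, b (x - w) h * g w
        map_add' := fun h h' => by
          rw [← integral_add (hbi x h) (hbi x h')]
          simp only [map_add, add_mul]
        map_smul' := fun c h => by
          simp only [map_smul, smul_eq_mul, mul_assoc, integral_const_mul, RingHom.id_apply] }
    have hL : ∀ x h, L x h = ∫ w, b (x - w) h * g w := fun x h => rfl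
    have hder : ∀ x, HasFDerivAt (fun v => ∫ w, K (v - w) * g w) (L x) x := by
      intro x
      have hjx := one_le_jap x
      rw [hasFDerivAt_iff_isLittleO]
      have hO : (fun y => (∫ w, K (y - w) * g w) - (∫ w, K (x - w) * g w) - L x (y - x)) =O[nhds x]
          fun y => ‖y - x‖ ^ 2 := by
        refine Asymptotics.IsBigO.of_bound (M * (6 ^ p * jap x ^ p) * ∫ w : E3, |g w| * jap w ^ p) ?_
        filter_upwards [Metric.ball_mem_nhds x one_pos] with y hy
        have hy' : ‖y - x‖ ≤ 1 := by rw [← dist_eq_norm]; exact (Metric.mem_ball.1 hy).le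
        have e : (∫ w, K (y - w) * g w) - (∫ w, K (x - w) * g w) - L x (y - x) =
            ∫ w, (K (y - w) - K (x - w) - b (x - w) (y - x)) * g w := by
          have hi : Integrable (fun w => K (y - w) * g w - K (x - w) * g w) := (hall y).sub (hall x)
          rw [hL, ← integral_sub (hall y) (hall x), ← integral_sub hi (hbi x _)]
          congr 1; funext w; ring
        rw [e, Real.norm_eq_abs, norm_pow, norm_norm]
        refine (dom_bound hp hg _ x y (c := M * ‖y - x‖ ^ 2) (by positivity) fun w => ?_).trans ?_
        · rw [abs_mul]
          gcongr
          exact h3' x y w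
        · calc _ ≤ M * ‖y - x‖ ^ 2 * (6 ^ p * jap x ^ p) * ∫ w : E3, |g w| * jap w ^ p := by
                refine mul_le_mul_of_nonneg_right ?_ hI
                exact mul_le_mul_of_nonneg_left (near_weight hp x y hy') (by positivity)
            _ = _ := by ring
      refine hO.trans_isLittleO ?_
      exact Asymptotics.isLittleO_pow_sub_sub x one_lt_two
    have hpd : pd k (fun v => ∫ w, K (v - w) * g w) =
        fun x => ∫ w, b (x - w) (EuclideanSpace.single k 1) * g w := by
      funext x
      unfold pd
      rw [(hder x).fderiv, hL]
    rw [hpd]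
    refine pd_bound _ l v hC fun y hy => ?_
    refine diff_bound (K := fun z => b z (EuclideanSpace.single k 1)) hp hM (fun x y => ?_) hg
      (fun x => hbi x _) v y hy
    refine le_trans ?_ (h2 x y)
    have := (b y - b x).le_opNorm (EuclideanSpace.single k 1)
    simpa using this
  · push Not at hall
    obtain ⟨v0, hv0⟩ := hall
    have hpd : pd k (fun v => ∫ w, K (v - w) * g w) = fun _ => 0 := by
      funext x
      unfold pd
      rw [fderiv_zero_of_affine _ {x | Integrable (fun w => K (x - w) * g w) volume}
        (fun x hx => integral_undef hx) ?_ v0 hv0 x]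
      · simp
      · intro x hx y hy t
        have hgm := hmeas x hx
        have e1 := hT hgm x (x + t • (y - x))
        have e2 := (hT hgm x y).const_mul t
        have hx' : Integrable (fun w => K (x - w) * g w) := hx
        have hy' : Integrable (fun w => K (y - w) * g w) := hy
        have := ((e1.sub e2).add ((hy'.const_mul t).sub (hx'.const_mul t))).add hx'
        refine this.congr (Eventually.of_forall fun w => ?_)
        simp only [Pi.sub_apply, Pi.add_apply, add_sub_cancel_left, map_smul, smul_eq_mul]
        ring
    rw [hpd, pd_zero]
    simpa using hC

end conv

lemma amat_zero_coord (γ : ℝ) (i j : Fin 3) (z : E3) (h : ∀ k, z k ≠ 0) : amat γ z i j ≠ 0 := by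
  have hz : z ≠ 0 := fun e => h 0 (by simp [e])
  have hr : 0 < ‖z‖ := norm_pos_iff.2 hz
  unfold amat
  refine mul_ne_zero (by positivity) ?_
  split_ifs with hij
  · subst hij
    intro he
    have h1 : z i * z i = ‖z‖ ^ 2 := by
      field_simp at he
      linarith
    rw [EuclideanSpace.real_norm_sq_eq, Fin.sum_univ_three] at h1
    have p0 := sq_pos_of_ne_zero (h 0)
    have p1 := sq_pos_of_ne_zero (h 1)
    have p2 := sq_pos_of_ne_zero (h 2)
    fin_cases i <;> simp at h1 <;> nlinarith
  · have := h i
    have := h j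
    rw [zero_sub]
    exact neg_ne_zero.2 (by positivity)

lemma coord_ne_ae : ∀ᵐ z : E3, ∀ k, z k ≠ 0 := by
  rw [ae_all_iff]
  intro k
  have := Measure.addHaar_submodule (volume : Measure E3)
    (LinearMap.ker ((EuclideanSpace.proj k : E3 →L[ℝ] ℝ) : E3 →ₗ[ℝ] ℝ)) (by
      intro e
      have hm : (EuclideanSpace.single k 1 : E3) ∈
        LinearMap.ker ((EuclideanSpace.proj k : E3 →L[ℝ] ℝ) : E3 →ₗ[ℝ] ℝ) := by
        rw [e]; trivial
      simp at hm)
  rw [ae_iff]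
  convert this using 2
  ext z
  simp

lemma amat_meas (γ : ℝ) (hγ0 : 0 ≤ γ) (i j : Fin 3) (g : E3 → ℝ) (v : E3)
    (h : Integrable (fun w => amat γ (v - w) i j * g w)) : AEStronglyMeasurable g := by
  have hc : Continuous (fun z => amat γ z i j) :=
    continuous_iff_continuousAt.2 fun z => (amat_hasFDerivAt γ hγ0 z i j).continuousAt
  have hne : ∀ᵐ w : E3, ∀ k, (v - w) k ≠ 0 :=
    (quasiMeasurePreserving_sub_left (volume : Measure E3) v).ae coord_ne_ae
  have hm : AEStronglyMeasurable (fun w => (amat γ (v - w) i j)⁻¹) := by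
    have : Measurable (fun w => amat γ (v - w) i j) :=
      (hc.comp (continuous_const.sub continuous_id)).measurable
    exact this.inv.aestronglyMeasurable
  refine (hm.mul h.1).congr ?_
  filter_upwards [hne] with w hw
  have := amat_zero_coord γ i j _ hw
  simp only [Pi.mul_apply]
  field_simp

lemma bk_cont (γ : ℝ) (hγ0 : 0 ≤ γ) (hγ1 : γ ≤ 1) (i j : Fin 3) : Continuous (bk γ i j) := by
  obtain ⟨M, hM0, -, hM2⟩ := bk_bounds γ hγ0 hγ1 i j
  rw [continuous_iff_continuousAt]
  intro x
  rw [ContinuousAt, tendsto_iff_norm_sub_tendsto_zero]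
  have ht : Tendsto (fun y : E3 => M * ‖y - x‖ * (‖y‖ + ‖x‖) ^ γ) (nhds x) (nhds 0) := by
    have : Continuous (fun y : E3 => M * ‖y - x‖ * (‖y‖ + ‖x‖) ^ γ) := by
      have : Continuous (fun y : E3 => (‖y‖ + ‖x‖) ^ γ) :=
        Continuous.rpow_const (by fun_prop) fun y => Or.inr hγ0
      fun_prop
    simpa using this.tendsto x
  exact squeeze_zero (fun y => norm_nonneg _) (fun y => hM2 y x) ht

lemma multi_one (β : Fin 3 → ℕ) (h : β 0 + β 1 + β 2 = 1) : ∃ k, ∀ f, multiDeriv β f = pd k f := by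
  have : (β 0 = 1 ∧ β 1 = 0 ∧ β 2 = 0) ∨ (β 0 = 0 ∧ β 1 = 1 ∧ β 2 = 0) ∨
    (β 0 = 0 ∧ β 1 = 0 ∧ β 2 = 1) := by omega
  rcases this with ⟨h0, h1, h2⟩ | ⟨h0, h1, h2⟩ | ⟨h0, h1, h2⟩
  · exact ⟨0, fun f => by simp [multiDeriv, h0, h1, h2]⟩
  · exact ⟨1, fun f => by simp [multiDeriv, h0, h1, h2]⟩
  · exact ⟨2, fun f => by simp [multiDeriv, h0, h1, h2]⟩

lemma multi_two (β : Fin 3 → ℕ) (h : β 0 + β 1 + β 2 = 2) :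
    ∃ k l, ∀ f, multiDeriv β f = pd l (pd k f) := by
  have : (β 0 = 2 ∧ β 1 = 0 ∧ β 2 = 0) ∨ (β 0 = 0 ∧ β 1 = 2 ∧ β 2 = 0) ∨
    (β 0 = 0 ∧ β 1 = 0 ∧ β 2 = 2) ∨ (β 0 = 1 ∧ β 1 = 1 ∧ β 2 = 0) ∨
    (β 0 = 1 ∧ β 1 = 0 ∧ β 2 = 1) ∨ (β 0 = 0 ∧ β 1 = 1 ∧ β 2 = 1) := by omega
  rcases this with ⟨h0, h1, h2⟩ | ⟨h0, h1, h2⟩ | ⟨h0, h1, h2⟩ | ⟨h0, h1, h2⟩ | ⟨h0, h1, h2⟩ | ⟨h0, h1, h2⟩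
  · exact ⟨0, 0, fun f => by simp [multiDeriv, h0, h1, h2]⟩
  · exact ⟨1, 1, fun f => by simp [multiDeriv, h0, h1, h2]⟩
  · exact ⟨2, 2, fun f => by simp [multiDeriv, h0, h1, h2]⟩
  · exact ⟨1, 0, fun f => by simp [multiDeriv, h0, h1, h2]⟩
  · exact ⟨2, 0, fun f => by simp [multiDeriv, h0, h1, h2]⟩
  · exact ⟨2, 1, fun f => by simp [multiDeriv, h0, h1, h2]⟩

lemma main_aux (γ : ℝ) (hγ0 : 0 ≤ γ) (hγ1 : γ ≤ 1)
    (β : Fin 3 → ℕ) (hβ : β 0 + β 1 + β 2 ≤ 2) (i j : Fin 3) :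
    ∃ C : ℝ, 0 ≤ C ∧ ∀ g : E3 → ℝ,
      Integrable (fun w : E3 => |g w| * jap w ^ (γ + 2 - ((β 0 + β 1 + β 2 : ℕ) : ℝ))) →
      ∀ (v : E3),
      |multiDeriv β (fun v => ∫ w : E3, amat γ (v - w) i j * g w) v| ≤
        C * jap v ^ (γ + 2 - ((β 0 + β 1 + β 2 : ℕ) : ℝ)) *
          ∫ w : E3, |g w| * jap w ^ (γ + 2 - ((β 0 + β 1 + β 2 : ℕ) : ℝ)) := by
  obtain ⟨M, hM, h0, h1, h2, h3⟩ := amat_kernel γ hγ0 hγ1 i j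
  have hc : Continuous (fun z => amat γ z i j) :=
    continuous_iff_continuousAt.2 fun z => (amat_hasFDerivAt γ hγ0 z i j).continuousAt
  have hmeas := amat_meas γ hγ0 i j
  refine ⟨M * 6 ^ (γ + 2 - ((β 0 + β 1 + β 2 : ℕ) : ℝ)), by positivity, ?_⟩
  generalize hn : β 0 + β 1 + β 2 = n at *
  have : n = 0 ∨ n = 1 ∨ n = 2 := by omega
  rcases this with rfl | rfl | rfl
  · have hm : ∀ f, multiDeriv β f = f := fun f => by
      have : β 0 = 0 ∧ β 1 = 0 ∧ β 2 = 0 := by omega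
      simp [multiDeriv, this]
    rw [show γ + 2 - ((0 : ℕ) : ℝ) = γ + 2 by simp]
    intro g hg v
    rw [hm]
    exact case_zero (K := fun z => amat γ z i j) (by linarith) hM h0 hg v
  · obtain ⟨k, hk⟩ := multi_one β hn
    rw [show γ + 2 - ((1 : ℕ) : ℝ) = γ + 1 by push_cast; ring]
    intro g hg v
    rw [hk]
    exact case_one (K := fun z => amat γ z i j) (by linarith) hM hc h1 (hmeas g) hg k v
  · obtain ⟨k, l, hk⟩ := multi_two β hn
    rw [show γ + 2 - ((2 : ℕ) : ℝ) = γ by push_cast; ring]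
    intro g hg v
    rw [hk]
    exact case_two (K := fun z => amat γ z i j) hγ0 hM hc (bk_cont γ hγ0 hγ1 i j) h2 h3 (hmeas g) hg k l v

/-- For `|β| ≤ 2` there is `C > 0` with
`|∂^β (a_{ij} * g)(v)| ≤ C ⟨v⟩^{γ+2-|β|} ∫ |g(w)| ⟨w⟩^{γ+2-|β|} dw`
for all `g ∈ L¹(⟨v⟩^{γ+2-|β|})`. -/
theorem stmt12 (γ : ℝ) (hγ0 : 0 ≤ γ) (hγ1 : γ ≤ 1)
    (β : Fin 3 → ℕ) (hβ : β 0 + β 1 + β 2 ≤ 2) :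
    ∃ C > (0 : ℝ), ∀ g : E3 → ℝ,
      Integrable (fun w : E3 => |g w| * jap w ^ (γ + 2 - ((β 0 + β 1 + β 2 : ℕ) : ℝ))) →
      ∀ (v : E3) (i j : Fin 3),
      |multiDeriv β (fun v => ∫ w : E3, amat γ (v - w) i j * g w) v| ≤
        C * jap v ^ (γ + 2 - ((β 0 + β 1 + β 2 : ℕ) : ℝ)) *
          ∫ w : E3, |g w| * jap w ^ (γ + 2 - ((β 0 + β 1 + β 2 : ℕ) : ℝ)) := by
  choose C hC0 hC using main_aux γ hγ0 hγ1 β hβ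
  have hS : 0 ≤ ∑ i, ∑ j, C i j := Finset.sum_nonneg fun i _ => Finset.sum_nonneg fun j _ => hC0 i j
  refine ⟨(∑ i, ∑ j, C i j) + 1, by linarith, fun g hg v i j => (hC i j g hg v).trans ?_⟩
  have hI : 0 ≤ ∫ w : E3, |g w| * jap w ^ (γ + 2 - ((β 0 + β 1 + β 2 : ℕ) : ℝ)) :=
    integral_nonneg fun w => mul_nonneg (abs_nonneg _) (Real.rpow_nonneg (Real.sqrt_nonneg _) _)
  have hJ : 0 ≤ jap v ^ (γ + 2 - ((β 0 + β 1 + β 2 : ℕ) : ℝ)) :=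
    Real.rpow_nonneg (Real.sqrt_nonneg _) _
  have h1 : C i j ≤ ∑ j, C i j :=
    Finset.single_le_sum (f := fun j => C i j) (fun j _ => hC0 i j) (Finset.mem_univ j)
  have h2 : ∑ j, C i j ≤ ∑ i, ∑ j, C i j :=
    Finset.single_le_sum (f := fun i => ∑ j, C i j)
      (fun i _ => Finset.sum_nonneg fun j _ => hC0 i j) (Finset.mem_univ i)
  refine mul_le_mul_of_nonneg_right (mul_le_mul_of_nonneg_right ?_ hJ) hI
  linarith
end
end
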